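/- arXiv:1901.10791 — 5 statements merged into one kernel-verified Lean document; each statement's English description precedes it below -/
import Mathlib

section
/- Let F : ℝ^{n×n} → ℝ be a convex, continuously differentiable function whose gradient is Lipschitz continuous with constant L_F (with respect to the Frobenius norm), and define f : ℝ^{n×r} → ℝ by f(X) = F(XXᵀ). Then for any parameters α ≥ 6·L_F and σ ≥ 2·‖∇F(0)‖, the function f is 1-smooth relative to the universal kernel h_u, i.e., for all X, Y ∈ ℝ^{n×r}: f(X) ≤ f(Y) + ⟨∇f(Y), X − Y⟩ + D_{h_u}(X, Y). -/
open Matrix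

attribute [local instance] Matrix.frobeniusNormedAddCommGroup Matrix.frobeniusNormedSpace

/-- Frobenius inner product `⟨X, Y⟩ = Tr(Xᵀ Y)`. -/
noncomputable def minner {n r : ℕ} (X Y : Matrix (Fin n) (Fin r) ℝ) : ℝ := (Xᵀ * Y).trace

/-- The continuous linear functional `U ↦ ⟨W, U⟩` (Frobenius inner product with `W`). -/
noncomputable def innerCLM {n r : ℕ} (W : Matrix (Fin n) (Fin r) ℝ) :
    Matrix (Fin n) (Fin r) ℝ →L[ℝ] ℝ :=
  LinearMap.toContinuousLinearMap
    { toFun := fun U => minner W U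
      map_add' := by intro U V; simp [minner, Matrix.mul_add]
      map_smul' := by intro c U; simp [minner, Matrix.mul_smul] }

/-- The universal kernel `h_u(X) = (α/4)‖X‖⁴ + (σ/2)‖X‖²` (Frobenius norm). -/
noncomputable def hu {n r : ℕ} (α σ : ℝ) (X : Matrix (Fin n) (Fin r) ℝ) : ℝ :=
  α / 4 * ‖X‖ ^ 4 + σ / 2 * ‖X‖ ^ 2


theorem aux_minner_sum {n r : ℕ} (X Y : Matrix (Fin n) (Fin r) ℝ) :
    minner X Y = ∑ p : Fin n × Fin r, X p.1 p.2 * Y p.1 p.2 := by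
  rw [Fintype.sum_prod_type, Finset.sum_comm]
  simp [minner, Matrix.trace, Matrix.mul_apply]

theorem aux_norm_sq {n r : ℕ} (X : Matrix (Fin n) (Fin r) ℝ) :
    ‖X‖ ^ 2 = minner X X := by
  rw [aux_minner_sum, Fintype.sum_prod_type, Matrix.frobenius_norm_def, ← Real.sqrt_eq_rpow,
    Real.sq_sqrt (by positivity)]
  simp [sq]

theorem aux_cs {n r : ℕ} (X Y : Matrix (Fin n) (Fin r) ℝ) :
    minner X Y ≤ ‖X‖ * ‖Y‖ := by
  refine (le_abs_self _).trans (abs_le_of_sq_le_sq ?_ (by positivity))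
  rw [mul_pow, aux_norm_sq, aux_norm_sq, aux_minner_sum, aux_minner_sum, aux_minner_sum]
  simp only [← sq]
  exact Finset.sum_mul_sq_le_sq_mul_sq _ _ _

theorem aux_add {n r : ℕ} (W X Y : Matrix (Fin n) (Fin r) ℝ) :
    minner W (X + Y) = minner W X + minner W Y := by
  simp [minner, Matrix.mul_add]

theorem aux_smul {n r : ℕ} (t : ℝ) (W X : Matrix (Fin n) (Fin r) ℝ) :
    minner W (t • X) = t * minner W X := by
  simp [minner]

theorem aux_comm {n r : ℕ} (X Y : Matrix (Fin n) (Fin r) ℝ) :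
    minner X Y = minner Y X := by
  simp [aux_minner_sum, mul_comm]

theorem aux_sub_left {n r : ℕ} (X Y W : Matrix (Fin n) (Fin r) ℝ) :
    minner (X - Y) W = minner X W - minner Y W := by
  simp [minner, Matrix.sub_mul]

theorem aux_norm_line {n r : ℕ} (t : ℝ) (Y D : Matrix (Fin n) (Fin r) ℝ) :
    ‖Y + t • D‖ ^ 2 = ‖Y‖ ^ 2 + 2 * t * minner Y D + t ^ 2 * ‖D‖ ^ 2 := by
  simp only [aux_norm_sq]
  rw [aux_add, aux_smul, aux_comm (Y + t • D) Y, aux_comm (Y + t • D) D, aux_add, aux_add,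
    aux_smul, aux_smul, aux_comm D Y]
  ring

theorem aux_line {n r : ℕ} (t : ℝ) (Y D : Matrix (Fin n) (Fin r) ℝ) :
    HasDerivAt (fun s : ℝ => Y + s • D) D t := by
  exact (((hasDerivAt_id t).smul_const D).const_add Y).congr_deriv (one_smul _ _)

theorem aux_dline {n r : ℕ} {G : Matrix (Fin n) (Fin r) ℝ → ℝ}
    {W : Matrix (Fin n) (Fin r) ℝ} {c : ℝ → Matrix (Fin n) (Fin r) ℝ}
    {D : Matrix (Fin n) (Fin r) ℝ} {t : ℝ}
    (hG : HasFDerivAt G (innerCLM W) (c t)) (hc : HasDerivAt c D t) :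
    HasDerivAt (fun s => G (c s)) (minner W D) t :=
  hG.comp_hasDerivAt t hc

theorem aux_descent {n : ℕ} (F : Matrix (Fin n) (Fin n) ℝ → ℝ)
    (F' : Matrix (Fin n) (Fin n) ℝ → Matrix (Fin n) (Fin n) ℝ) (L : ℝ)
    (hFgrad : ∀ Y, HasFDerivAt F (innerCLM (F' Y)) Y)
    (hFlip : ∀ Y₁ Y₂, ‖F' Y₁ - F' Y₂‖ ≤ L * ‖Y₁ - Y₂‖)
    (A E : Matrix (Fin n) (Fin n) ℝ) :
    F (A + E) ≤ F A + minner (F' A) E + L / 2 * ‖E‖ ^ 2 := by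
  have hd : ∀ t : ℝ, HasDerivAt
      (fun s : ℝ => F (A + s • E) - s * minner (F' A) E - s ^ 2 * (L / 2 * ‖E‖ ^ 2))
      (minner (F' (A + t • E)) E - minner (F' A) E - (2 * t) * (L / 2 * ‖E‖ ^ 2)) t := by
    intro t
    have h1 := aux_dline (hFgrad (A + t • E)) (aux_line t A E)
    have h2 := (hasDerivAt_id t).mul_const (minner (F' A) E)
    have h3 := (hasDerivAt_pow 2 t).mul_const (L / 2 * ‖E‖ ^ 2)
    have := (h1.sub h2).sub h3
    exact this.congr_deriv (by simp)
  have hanti : AntitoneOn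
      (fun s : ℝ => F (A + s • E) - s * minner (F' A) E - s ^ 2 * (L / 2 * ‖E‖ ^ 2))
      (Set.Icc 0 1) := by
    apply antitoneOn_of_hasDerivWithinAt_nonpos (convex_Icc 0 1)
      (fun t _ => (hd t).continuousAt.continuousWithinAt)
      (fun t _ => (hd t).hasDerivWithinAt)
    intro t ht
    rw [interior_Icc] at ht
    have h1 := aux_cs (F' (A + t • E) - F' A) E
    have h2 := hFlip (A + t • E) A
    rw [add_sub_cancel_left, norm_smul, Real.norm_eq_abs, abs_of_pos ht.1] at h2
    rw [aux_sub_left] at h1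
    have h3 := mul_le_mul_of_nonneg_right h2 (norm_nonneg E)
    nlinarith
  have := hanti (Set.left_mem_Icc.2 zero_le_one) (Set.right_mem_Icc.2 zero_le_one) zero_le_one
  simp at this
  linarith

/-- Proposition 1, universality of `h_u`. If `F` is convex, continuously
differentiable with gradient `F'` Lipschitz with constant `L_F` (Frobenius norm), and
`f(X) = F(XXᵀ)` has gradient `f'`, then for `α ≥ 6 L_F` and `σ ≥ 2‖∇F(0)‖`, `f` is
`1`-smooth relative to `h_u`:
`f(X) ≤ f(Y) + ⟨∇f(Y), X − Y⟩ + D_{h_u}(X, Y)` for all `X, Y`. -/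
theorem universal_kernel_relative_smoothness {n r : ℕ}
    (F : Matrix (Fin n) (Fin n) ℝ → ℝ)
    (F' : Matrix (Fin n) (Fin n) ℝ → Matrix (Fin n) (Fin n) ℝ)
    (f : Matrix (Fin n) (Fin r) ℝ → ℝ)
    (f' hu' : Matrix (Fin n) (Fin r) ℝ → Matrix (Fin n) (Fin r) ℝ)
    (L_F α σ : ℝ) (hLF : 0 ≤ L_F)
    (hFconv : ConvexOn ℝ Set.univ F)
    (hFgrad : ∀ Y, HasFDerivAt F (innerCLM (F' Y)) Y)
    (hFgradcont : Continuous F')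
    (hFlip : ∀ Y₁ Y₂, ‖F' Y₁ - F' Y₂‖ ≤ L_F * ‖Y₁ - Y₂‖)
    (hfdef : ∀ X, f X = F (X * Xᵀ))
    (hfgrad : ∀ X, HasFDerivAt f (innerCLM (f' X)) X)
    (hugrad : ∀ X, HasFDerivAt (hu α σ) (innerCLM (hu' X)) X)
    (hα : 6 * L_F ≤ α) (hσ : 2 * ‖F' 0‖ ≤ σ) :
    ∀ X Y : Matrix (Fin n) (Fin r) ℝ,
      f X ≤ f Y + minner (f' Y) (X - Y) +
        (hu α σ X - hu α σ Y - minner (hu' Y) (X - Y)) := by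
  intro X Y
  obtain ⟨D, rfl⟩ : ∃ D, X = Y + D := ⟨X - Y, by simp⟩
  rw [add_sub_cancel_left]
  have hg : minner (f' Y) D = minner (F' (Y * Yᵀ)) (Y * Dᵀ + D * Yᵀ) := by
    have h0 : HasFDerivAt f (innerCLM (f' Y)) (Y + (0:ℝ) • D) := by simpa using hfgrad Y
    have h1 := aux_dline h0 (aux_line 0 Y D)
    have hc : HasDerivAt (fun s : ℝ => Y * Yᵀ + s • (Y * Dᵀ + D * Yᵀ) + s ^ 2 • (D * Dᵀ))
        (Y * Dᵀ + D * Yᵀ) 0 := by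
      have := (aux_line 0 (Y * Yᵀ) (Y * Dᵀ + D * Yᵀ)).add
        ((hasDerivAt_pow 2 (0:ℝ)).smul_const (D * Dᵀ))
      exact this.congr_deriv (by simp)
    have h2 : HasFDerivAt F (innerCLM (F' (Y * Yᵀ)))
        (Y * Yᵀ + (0:ℝ) • (Y * Dᵀ + D * Yᵀ) + (0:ℝ) ^ 2 • (D * Dᵀ)) := by
      simpa using hFgrad (Y * Yᵀ)
    have h3 := aux_dline
      (c := fun s : ℝ => Y * Yᵀ + s • (Y * Dᵀ + D * Yᵀ) + s ^ 2 • (D * Dᵀ)) h2 hc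
    refine h1.unique ?_
    refine h3.congr_of_eventuallyEq (Filter.Eventually.of_forall fun s => ?_)
    simp only [hfdef]
    congr 1
    simp only [Matrix.transpose_add, Matrix.transpose_smul, Matrix.add_mul, Matrix.mul_add,
      Matrix.smul_mul, Matrix.mul_smul, smul_add, smul_smul, sq]
    abel
  have hh : minner (hu' Y) D = α * ‖Y‖ ^ 2 * minner Y D + σ * minner Y D := by
    have h0 : HasFDerivAt (hu α σ) (innerCLM (hu' Y)) (Y + (0:ℝ) • D) := by simpa using hugrad Y
    have h1 := aux_dline h0 (aux_line 0 Y D)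
    refine h1.unique ?_
    have hq : HasDerivAt (fun t : ℝ => ‖Y‖ ^ 2 + t * (2 * minner Y D) + t ^ 2 * ‖D‖ ^ 2)
        (2 * minner Y D) 0 := by
      have := (((hasDerivAt_id (0:ℝ)).mul_const (2 * minner Y D)).const_add (‖Y‖ ^ 2)).add
        ((hasDerivAt_pow 2 (0:ℝ)).mul_const (‖D‖ ^ 2))
      exact this.congr_deriv (by simp)
    have h3 := ((hq.pow 2).const_mul (α / 4)).add (hq.const_mul (σ / 2))
    refine (h3.congr_of_eventuallyEq (Filter.Eventually.of_forall fun s => ?_)).congr_deriv ?_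
    · have := aux_norm_line s Y D
      simp only [hu, Pi.add_apply, Pi.pow_apply]
      rw [show ‖Y + s • D‖ ^ 4 = (‖Y + s • D‖ ^ 2) ^ 2 by ring, this]
      ring
    · simp
      ring
  have hE : (Y + D) * (Y + D)ᵀ = Y * Yᵀ + (Y * Dᵀ + D * Yᵀ + D * Dᵀ) := by
    simp only [Matrix.transpose_add, Matrix.add_mul, Matrix.mul_add]
    abel
  have hdesc := aux_descent F F' L_F hFgrad hFlip (Y * Yᵀ) (Y * Dᵀ + D * Yᵀ + D * Dᵀ)
  rw [← hE, aux_add] at hdesc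
  have hEn : ‖Y * Dᵀ + D * Yᵀ + D * Dᵀ‖ ≤ 2 * ‖Y + (1/2:ℝ) • D‖ * ‖D‖ := by
    have e : Y * Dᵀ + D * Yᵀ + D * Dᵀ
        = (Y + (1/2:ℝ) • D) * Dᵀ + D * (Y + (1/2:ℝ) • D)ᵀ := by
      have : D * Dᵀ = (1/2:ℝ) • (D * Dᵀ) + (1/2:ℝ) • (D * Dᵀ) := by
        rw [← add_smul]; norm_num
      simp only [Matrix.transpose_add, Matrix.transpose_smul, Matrix.add_mul, Matrix.mul_add,
        Matrix.smul_mul, Matrix.mul_smul]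
      nth_rewrite 1 [this]
      abel
    rw [e]
    have n1 := Matrix.frobenius_norm_mul (Y + (1/2:ℝ) • D) Dᵀ
    have n2 := Matrix.frobenius_norm_mul D (Y + (1/2:ℝ) • D)ᵀ
    rw [Matrix.frobenius_norm_transpose] at n1 n2
    have n3 := norm_add_le ((Y + (1/2:ℝ) • D) * Dᵀ) (D * (Y + (1/2:ℝ) • D)ᵀ)
    linarith
  have hEsq : ‖Y * Dᵀ + D * Yᵀ + D * Dᵀ‖ ^ 2
      ≤ 4 * (‖Y‖ ^ 2 + minner Y D + ‖D‖ ^ 2 / 4) * ‖D‖ ^ 2 := by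
    have := pow_le_pow_left₀ (norm_nonneg _) hEn 2
    rw [mul_pow, mul_pow, aux_norm_line] at this
    linarith
  have hDD : minner (F' (Y * Yᵀ)) (D * Dᵀ) ≤ (‖F' 0‖ + L_F * ‖Y‖ ^ 2) * ‖D‖ ^ 2 := by
    have n1 := Matrix.frobenius_norm_mul D Dᵀ
    have n2 := Matrix.frobenius_norm_mul Y Yᵀ
    rw [Matrix.frobenius_norm_transpose, ← sq] at n1 n2
    have n3 := hFlip (Y * Yᵀ) 0
    rw [sub_zero] at n3
    have n4 := norm_sub_norm_le (F' (Y * Yᵀ)) (F' 0)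
    have n5 := mul_le_mul_of_nonneg_left n2 hLF
    refine (aux_cs _ _).trans (mul_le_mul (by linarith) n1 (norm_nonneg _) (by positivity))
  have hN := aux_norm_line 1 Y D
  rw [one_smul] at hN
  have hF1 := mul_le_mul_of_nonneg_left hEsq (half_pos (zero_lt_one' ℝ)).le
  have hF2 := mul_le_mul_of_nonneg_left hEsq (div_nonneg hLF (zero_le_two (α := ℝ)))
  rw [hfdef, hfdef, hg, hh]
  simp only [hu]
  rw [show ‖Y + D‖ ^ 4 = (‖Y + D‖ ^ 2) ^ 2 by ring, hN]
  generalize minner Y D = c at *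
  generalize ‖Y‖ = a at *
  generalize ‖D‖ = d at *
  have k1 : 0 ≤ (σ - 2 * ‖F' 0‖) * d ^ 2 := mul_nonneg (by linarith) (sq_nonneg _)
  have k2 : 0 ≤ (α - 6 * L_F) * ((c + d ^ 2 / 2) ^ 2 + (a * d) ^ 2 / 2) :=
    mul_nonneg (by linarith) (by positivity)
  have k3 : 0 ≤ L_F * (2 * c ^ 2 + (2 * c + d ^ 2) ^ 2) := mul_nonneg hLF (by positivity)
  linarith
end

section
/- Let α, β ≥ 0 and σ > 0. The Gram kernel h_g(X) = (α/4)‖X‖⁴ + (β/4)‖XᵀX‖² + (σ/2)‖X‖² is σ-strongly convex on ℝ^{n×r} (with respect to the Frobenius norm); in particular it is strictly convex. -/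
open Matrix

attribute [local instance] Matrix.frobeniusNormedAddCommGroup Matrix.frobeniusNormedSpace

/-- The Gram kernel `h_g(X) = (α/4)‖X‖⁴ + (β/4)‖XᵀX‖² + (σ/2)‖X‖²` (Frobenius norms). -/
noncomputable def hg {n r : ℕ} (α β σ : ℝ) (X : Matrix (Fin n) (Fin r) ℝ) : ℝ :=
  α / 4 * ‖X‖ ^ 4 + β / 4 * ‖Xᵀ * X‖ ^ 2 + σ / 2 * ‖X‖ ^ 2

lemma gk_norm_sq {m k : ℕ} (A : Matrix (Fin m) (Fin k) ℝ) :
    ‖A‖ ^ 2 = (Aᵀ * A).trace := by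
  rw [Matrix.frobenius_norm_def, ← Real.sqrt_eq_rpow, Real.sq_sqrt (by positivity)]
  simp only [Matrix.trace, Matrix.diag, Matrix.mul_apply, Matrix.transpose_apply]
  rw [Finset.sum_comm]
  refine Finset.sum_congr rfl fun i _ => Finset.sum_congr rfl fun j _ => ?_
  rw [Real.rpow_two, Real.norm_eq_abs, sq_abs, sq]

lemma gk_comb {m k : ℕ} (X Y : Matrix (Fin m) (Fin k) ℝ) (a b : ℝ) (hab : a + b = 1) :
    a • (Xᵀ * X) + b • (Yᵀ * Y) =
      (a • X + b • Y)ᵀ * (a • X + b • Y) + (a * b) • ((X - Y)ᵀ * (X - Y)) := by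
  obtain rfl : b = 1 - a := by linarith
  simp only [Matrix.transpose_add, Matrix.transpose_sub, Matrix.transpose_smul, Matrix.add_mul,
    Matrix.mul_add, Matrix.sub_mul, Matrix.mul_sub, Matrix.smul_mul, Matrix.mul_smul]
  module

lemma gk_sq {m k : ℕ} (X Y : Matrix (Fin m) (Fin k) ℝ) (a b : ℝ) (hab : a + b = 1) :
    a * ‖X‖ ^ 2 + b * ‖Y‖ ^ 2 = ‖a • X + b • Y‖ ^ 2 + a * b * ‖X - Y‖ ^ 2 := by
  have h := congrArg Matrix.trace (gk_comb X Y a b hab)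
  simpa only [Matrix.trace_add, Matrix.trace_smul, smul_eq_mul, ← gk_norm_sq] using h

lemma gk_mono {m k : ℕ} (Z D : Matrix (Fin m) (Fin k) ℝ) (c : ℝ) (hc : 0 ≤ c) :
    ‖Zᵀ * Z‖ ≤ ‖Zᵀ * Z + c • (Dᵀ * D)‖ := by
  refine le_of_sq_le_sq ?_ (norm_nonneg _)
  have e : ‖Zᵀ * Z + c • (Dᵀ * D)‖ ^ 2
      = ‖Zᵀ * Z‖ ^ 2 + 2 * c * ‖Z * Dᵀ‖ ^ 2 + c ^ 2 * ‖Dᵀ * D‖ ^ 2 := by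
    have h1 : (Zᵀ * Z * (Dᵀ * D)).trace = ‖Z * Dᵀ‖ ^ 2 := by
      rw [gk_norm_sq, Matrix.transpose_mul, Matrix.transpose_transpose, ← Matrix.mul_assoc,
        Matrix.trace_mul_comm]
      simp only [Matrix.mul_assoc]
    have h2 : (Dᵀ * D * (Zᵀ * Z)).trace = ‖Z * Dᵀ‖ ^ 2 := by
      rw [Matrix.trace_mul_comm, h1]
    have h3 : (Zᵀ * Z * (Zᵀ * Z)).trace = ‖Zᵀ * Z‖ ^ 2 := by
      rw [gk_norm_sq, Matrix.transpose_mul, Matrix.transpose_transpose]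
    have h4 : (Dᵀ * D * (Dᵀ * D)).trace = ‖Dᵀ * D‖ ^ 2 := by
      rw [gk_norm_sq, Matrix.transpose_mul, Matrix.transpose_transpose]
    rw [gk_norm_sq (Zᵀ * Z + c • (Dᵀ * D))]
    rw [Matrix.transpose_add, Matrix.transpose_smul, Matrix.transpose_mul, Matrix.transpose_mul,
      Matrix.transpose_transpose, Matrix.transpose_transpose, Matrix.add_mul, Matrix.mul_add,
      Matrix.mul_add, Matrix.smul_mul, Matrix.smul_mul, Matrix.mul_smul, Matrix.mul_smul]
    simp only [Matrix.trace_add, Matrix.trace_smul, smul_eq_mul, h1, h2, h3, h4]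
    ring
  rw [e]
  have := mul_nonneg hc (sq_nonneg ‖Z * Dᵀ‖)
  nlinarith [mul_nonneg (sq_nonneg c) (sq_nonneg ‖Dᵀ * D‖)]

lemma gk_gram {m k : ℕ} :
    ConvexOn ℝ Set.univ (fun X : Matrix (Fin m) (Fin k) ℝ => ‖Xᵀ * X‖) := by
  refine ⟨convex_univ, fun X _ Y _ a b ha hb hab => ?_⟩
  have h := gk_mono (a • X + b • Y) (X - Y) (a * b) (mul_nonneg ha hb)
  rw [← gk_comb X Y a b hab] at h
  refine h.trans ((norm_add_le _ _).trans ?_)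
  rw [norm_smul, norm_smul, Real.norm_of_nonneg ha, Real.norm_of_nonneg hb, smul_eq_mul,
    smul_eq_mul]

/-- The Gram kernel is `σ`-strongly convex w.r.t. the Frobenius norm
(i.e. `h_g − (σ/2)‖·‖²` is convex); in particular it is strictly convex. -/
theorem gram_kernel_strongly_convex {n r : ℕ} (α β σ : ℝ) (hα : 0 ≤ α) (hβ : 0 ≤ β)
    (hσ : 0 < σ) :
    ConvexOn ℝ Set.univ
      (fun X : Matrix (Fin n) (Fin r) ℝ => hg α β σ X - σ / 2 * ‖X‖ ^ 2) ∧
    StrictConvexOn ℝ Set.univ (hg α β σ (n := n) (r := r)) := by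
  have key : ConvexOn ℝ Set.univ
      (fun X : Matrix (Fin n) (Fin r) ℝ => hg α β σ X - σ / 2 * ‖X‖ ^ 2) := by
    have h1 : ConvexOn ℝ Set.univ (fun X : Matrix (Fin n) (Fin r) ℝ => ‖X‖ ^ 4) :=
      (convexOn_univ_norm (E := Matrix (Fin n) (Fin r) ℝ)).pow (fun _ _ => norm_nonneg _) 4
    have h2 : ConvexOn ℝ Set.univ (fun X : Matrix (Fin n) (Fin r) ℝ => ‖Xᵀ * X‖ ^ 2) :=
      gk_gram.pow (fun _ _ => norm_nonneg _) 2
    have h3 := (h1.smul (c := α / 4) (by positivity)).add (h2.smul (c := β / 4) (by positivity))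
    refine h3.congr fun X _ => ?_
    simp [hg]
  refine ⟨key, convex_univ, fun X _ Y _ hXY a b ha hb hab => ?_⟩
  have h := key.2 (Set.mem_univ X) (Set.mem_univ Y) ha.le hb.le hab
  have e := gk_sq X Y a b hab
  have hp : 0 < ‖X - Y‖ := norm_pos_iff.2 (sub_ne_zero.2 hXY)
  have hq : 0 < σ / 2 * (a * b * ‖X - Y‖ ^ 2) := by positivity
  simp only [smul_eq_mul] at h ⊢
  linear_combination h + hq - σ / 2 * e
end

section
/- Let α, β ≥ 0, σ > 0, and η ∈ ℝ^r with η_i ≥ 0 for all i. Then the function φ(x) = (α/4)‖x‖⁴ + (β/4)Σᵢ x_i⁴ + (σ/2)‖x‖² − Σᵢ η_i x_i on ℝ^r is strictly convex and has a unique global minimizer μ; moreover μ_i ≥ 0 for all i, and μ satisfies the first-order conditions (α‖μ‖² + β·μ_i² + σ)·μ_i = η_i for each i = 1, …, r. -/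
/-- The `r`-dimensional subproblem objective
`φ(x) = (α/4)‖x‖⁴ + (β/4)Σᵢ xᵢ⁴ + (σ/2)‖x‖² − Σᵢ ηᵢ xᵢ` (Euclidean norm). -/
noncomputable def subphi {r : ℕ} (α β σ : ℝ) (η : EuclideanSpace ℝ (Fin r))
    (x : EuclideanSpace ℝ (Fin r)) : ℝ :=
  α / 4 * ‖x‖ ^ 4 + β / 4 * ∑ i, (x i) ^ 4 + σ / 2 * ‖x‖ ^ 2 - ∑ i, η i * x i

theorem subphi_strict {r : ℕ} (α β σ : ℝ) (hα : 0 ≤ α) (hβ : 0 ≤ β)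
    (hσ : 0 < σ) (η : EuclideanSpace ℝ (Fin r)) :
    StrictConvexOn ℝ Set.univ (subphi α β σ η) := by
  refine StrongConvexOn.strictConvexOn (m := σ) ?_ hσ
  rw [strongConvexOn_iff_convex]
  have h1 : ConvexOn ℝ Set.univ (fun x : EuclideanSpace ℝ (Fin r) => α / 4 * ‖x‖ ^ 4) := by
    have := (convexOn_univ_norm (E := EuclideanSpace ℝ (Fin r))).pow (fun x _ => norm_nonneg x) 4
    exact this.smul (by positivity : 0 ≤ α / 4)
  have h2 : ConvexOn ℝ Set.univ
      (fun x : EuclideanSpace ℝ (Fin r) => β / 4 * ∑ i, (x i) ^ 4) := by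
    have h : ∀ s : Finset (Fin r), ConvexOn ℝ Set.univ
        (fun x : EuclideanSpace ℝ (Fin r) => ∑ i ∈ s, (x i) ^ 4) := by
      intro s
      induction s using Finset.induction_on with
      | empty => simpa using convexOn_const (0:ℝ) convex_univ
      | insert a s ha ih =>
        simp only [Finset.sum_insert ha]
        have h4 : ConvexOn ℝ Set.univ (fun x : EuclideanSpace ℝ (Fin r) => (x a) ^ 4) :=
          (Even.convexOn_pow (n := 4) (by decide) :
            ConvexOn ℝ Set.univ (fun x : ℝ => x ^ 4)).comp_linearMap
            (EuclideanSpace.proj a : EuclideanSpace ℝ (Fin r) →L[ℝ] ℝ).toLinearMap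
        exact h4.add ih
    exact (h Finset.univ).smul (by positivity : 0 ≤ β / 4)
  have h3 : ConvexOn ℝ Set.univ (fun x : EuclideanSpace ℝ (Fin r) => - ∑ i, η i * x i) := by
    refine ⟨convex_univ, fun x _ y _ a b _ _ _ => le_of_eq ?_⟩
    simp only [PiLp.add_apply, PiLp.smul_apply, smul_eq_mul, mul_neg, Finset.mul_sum]
    rw [← neg_add, ← Finset.sum_add_distrib]
    congr 1
    exact Finset.sum_congr rfl fun i _ => by ring
  refine ((h1.add h2).add h3).congr fun x _ => ?_
  simp only [subphi, Pi.add_apply]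
  ring

theorem subphi_exists_min {r : ℕ} (α β σ : ℝ) (hα : 0 ≤ α) (hβ : 0 ≤ β)
    (hσ : 0 < σ) (η : EuclideanSpace ℝ (Fin r)) :
    ∃ μ, ∀ x, subphi α β σ η μ ≤ subphi α β σ η x := by
  have hc : Continuous (subphi α β σ η) := by
    unfold subphi
    fun_prop
  apply hc.exists_forall_le
  have hb : ∀ x, ‖x‖ * (σ / 2 * ‖x‖ - ‖η‖) ≤ subphi α β σ η x := by
    intro x
    have h1 : ∑ i, η i * x i ≤ ‖η‖ * ‖x‖ := by
      have := real_inner_le_norm x η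
      simp only [PiLp.inner_apply, RCLike.inner_apply, conj_trivial] at this
      linarith
    have h2 : 0 ≤ α / 4 * ‖x‖ ^ 4 := by positivity
    have h3 : 0 ≤ β / 4 * ∑ i, (x i) ^ 4 :=
      mul_nonneg (by positivity) (Finset.sum_nonneg fun i _ => by positivity)
    unfold subphi
    nlinarith
  refine Filter.tendsto_atTop_mono hb ?_
  have hn := tendsto_norm_cocompact_atTop (E := EuclideanSpace ℝ (Fin r))
  refine hn.atTop_mul_atTop₀ ?_
  exact Filter.tendsto_atTop_add_const_right _ (-‖η‖)
    (hn.const_mul_atTop (by positivity : 0 < σ / 2))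

theorem subphi_foc {r : ℕ} (α β σ : ℝ) (η μ : EuclideanSpace ℝ (Fin r))
    (hμ : ∀ x, subphi α β σ η μ ≤ subphi α β σ η x) (i : Fin r) :
    (α * ‖μ‖ ^ 2 + β * (μ i) ^ 2 + σ) * μ i = η i := by
  set N := ‖μ‖ ^ 2 with hN
  set A := β / 4 * ∑ j ∈ Finset.univ.erase i, (μ j) ^ 4 with hA
  set B := ∑ j ∈ Finset.univ.erase i, η j * μ j with hB
  let g : ℝ → ℝ := fun t => α / 4 * (N + 2 * t * μ i + t ^ 2) ^ 2 +
    (A + β / 4 * (μ i + t) ^ 4) + σ / 2 * (N + 2 * t * μ i + t ^ 2) - (B + η i * (μ i + t))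
  have key : ∀ t, subphi α β σ η (μ + t • EuclideanSpace.single i (1:ℝ)) = g t := by
    intro t
    have hn : ‖μ + t • EuclideanSpace.single i (1:ℝ)‖ ^ 2 = N + 2 * t * μ i + t ^ 2 := by
      rw [norm_add_sq_real, inner_smul_right, norm_smul, EuclideanSpace.inner_single_right]
      simp [hN]
      ring
    have h4 : ‖μ + t • EuclideanSpace.single i (1:ℝ)‖ ^ 4 = (N + 2 * t * μ i + t ^ 2) ^ 2 := by
      rw [← hn]; ring
    have hj : ∀ j ∈ Finset.univ.erase i, (μ + t • EuclideanSpace.single i (1:ℝ)) j = μ j := by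
      intro j hj
      simp [Finset.ne_of_mem_erase hj]
    have hi : (μ + t • EuclideanSpace.single i (1:ℝ)) i = μ i + t := by simp
    unfold subphi
    rw [hn, h4, ← Finset.sum_erase_add _ _ (Finset.mem_univ i),
      ← Finset.sum_erase_add (a := i) _ (fun j => η j * _) (Finset.mem_univ i), hi]
    have e1 : ∑ j ∈ Finset.univ.erase i, ((μ + t • EuclideanSpace.single i (1:ℝ)) j) ^ 4 =
        ∑ j ∈ Finset.univ.erase i, (μ j) ^ 4 :=
      Finset.sum_congr rfl fun j h => by rw [hj j h]
    have e2 : ∑ j ∈ Finset.univ.erase i, η j * (μ + t • EuclideanSpace.single i (1:ℝ)) j =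
        ∑ j ∈ Finset.univ.erase i, η j * μ j :=
      Finset.sum_congr rfl fun j h => by rw [hj j h]
    rw [e1, e2]
    simp only [g, hA, hB]
    ring
  have hmin : IsLocalMin g 0 := by
    refine Filter.Eventually.of_forall fun t => ?_
    rw [← key, ← key]
    simpa using hμ _
  have hl : HasDerivAt (fun t : ℝ => N + 2 * t * μ i + t ^ 2) (2 * μ i) 0 := by
    have := ((((hasDerivAt_id (0:ℝ)).const_mul 2).mul_const (μ i)).const_add N).add
      ((hasDerivAt_id (0:ℝ)).pow 2)
    exact this.congr_deriv (by simp)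
  have hm : HasDerivAt (fun t : ℝ => μ i + t) 1 0 := (hasDerivAt_id (0:ℝ)).const_add _
  have hd := ((((hl.pow 2).const_mul (α / 4)).add (((hm.pow 4).const_mul (β / 4)).const_add A)).add
    (hl.const_mul (σ / 2))).sub ((hm.const_mul (η i)).const_add B)
  have h0 := hmin.hasDerivAt_eq_zero hd
  norm_num at h0
  linarith

theorem subproblem_unique_minimizer {r : ℕ} (α β σ : ℝ) (hα : 0 ≤ α) (hβ : 0 ≤ β)
    (hσ : 0 < σ) (η : EuclideanSpace ℝ (Fin r)) (hη : ∀ i, 0 ≤ η i) :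
    StrictConvexOn ℝ Set.univ (subphi α β σ η) ∧
    ∃ μ : EuclideanSpace ℝ (Fin r),
      (∀ x, subphi α β σ η μ ≤ subphi α β σ η x) ∧
      (∀ x, (∀ y, subphi α β σ η x ≤ subphi α β σ η y) → x = μ) ∧
      (∀ i, 0 ≤ μ i) ∧
      (∀ i, (α * ‖μ‖ ^ 2 + β * (μ i) ^ 2 + σ) * μ i = η i) := by
  have hs := subphi_strict α β σ hα hβ hσ η
  obtain ⟨μ, hμ⟩ := subphi_exists_min α β σ hα hβ hσ η
  have hf := subphi_foc α β σ η μ hμ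
  refine ⟨hs, μ, hμ, fun x hx => ?_, fun i => ?_, hf⟩
  · exact hs.eq_of_isMinOn (fun y _ => hx y) (fun y _ => hμ y) trivial trivial
  · have hp : 0 < α * ‖μ‖ ^ 2 + β * (μ i) ^ 2 + σ := by positivity
    have := hη i
    rw [← hf i] at this
    exact nonneg_of_mul_nonneg_right this hp
end

section
/- Let α, β ≥ 0, σ > 0, and η ∈ ℝ^r. The function φ(x) = (α/4)‖x‖⁴ + (β/4)Σᵢ x_i⁴ + (σ/2)‖x‖² − Σᵢ η_i x_i on ℝ^r is 1-smooth relative to the kernel h(x) = ((α + 3β)/4)‖x‖⁴ + (σ/2)‖x‖², i.e., for all x, y ∈ ℝ^r: φ(x) ≤ φ(y) + ⟨∇φ(y), x − y⟩ + D_h(x, y). -/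
open RealInnerProductSpace

/-- The kernel `h(x) = ((α + 3β)/4)‖x‖⁴ + (σ/2)‖x‖²` on `ℝ^r`. -/
noncomputable def subker {r : ℕ} (α β σ : ℝ) (x : EuclideanSpace ℝ (Fin r)) : ℝ :=
  (α + 3 * β) / 4 * ‖x‖ ^ 4 + σ / 2 * ‖x‖ ^ 2


lemma aux_phi_inner {r : ℕ} (α β σ : ℝ) (η y v : EuclideanSpace ℝ (Fin r)) :
    ⟪gradient (subphi α β σ η) y, v⟫ = α * ‖y‖ ^ 2 * ⟪y, v⟫ + β * ∑ i, (y i) ^ 3 * v i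
      + σ * ⟪y, v⟫ - ∑ i, η i * v i := by
  have hn : HasFDerivAt (fun x : EuclideanSpace ℝ (Fin r) => ‖x‖ ^ 2) (2 • innerSL ℝ y) y :=
    (hasStrictFDerivAt_norm_sq y).hasFDerivAt
  have hc : ∀ i, HasFDerivAt (fun x : EuclideanSpace ℝ (Fin r) => x i)
      (EuclideanSpace.proj i : EuclideanSpace ℝ (Fin r) →L[ℝ] ℝ) y := fun i =>
    (EuclideanSpace.proj i : EuclideanSpace ℝ (Fin r) →L[ℝ] ℝ).hasFDerivAt
  have h1 := (((hn.pow 2).const_mul (α / 4)).add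
    ((HasFDerivAt.fun_sum (u := Finset.univ) (fun i _ => (hc i).pow 4)).const_mul (β / 4))).add
    (hn.const_mul (σ / 2))
  have h2 := h1.sub (HasFDerivAt.fun_sum (u := Finset.univ) (fun i _ => (hc i).const_mul (η i)))
  have he : subphi α β σ η = (((fun y => α / 4 * (‖y‖ ^ 2) ^ 2) + fun y => β / 4 * ∑ i, y i ^ 4)
      + fun y => σ / 2 * ‖y‖ ^ 2) - fun y => ∑ i, η i * y i := by
    funext x
    simp only [subphi, Pi.add_apply, Pi.sub_apply]
    ring
  have h3 := h2.fderiv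
  rw [← he] at h3
  unfold gradient
  rw [InnerProductSpace.toDual_symm_apply]
  refine (congrArg (fun L => L v) h3).trans ?_
  simp [ContinuousLinearMap.sum_apply, Finset.mul_sum]
  have : ∀ i, β / 4 * (4 * y i ^ 3 * v i) = β * (y i ^ 3 * v i) := fun i => by ring
  simp only [this]
  ring

lemma aux_ker_inner {r : ℕ} (α β σ : ℝ) (y v : EuclideanSpace ℝ (Fin r)) :
    ⟪gradient (subker α β σ) y, v⟫ = (α + 3 * β) * ‖y‖ ^ 2 * ⟪y, v⟫ + σ * ⟪y, v⟫ := by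
  have he : subker α β σ = subphi (α + 3 * β) 0 σ (0 : EuclideanSpace ℝ (Fin r)) := by
    funext x
    simp [subker, subphi]
  rw [he, aux_phi_inner]
  simp

lemma aux_ineq {r : ℕ} (y d : Fin r → ℝ) :
    ∑ i, d i ^ 2 * (6 * y i ^ 2 + 4 * (y i * d i) + d i ^ 2) ≤
      (∑ i, d i ^ 2) * (6 * ∑ i, y i ^ 2 + 4 * ∑ i, y i * d i + ∑ i, d i ^ 2) := by
  have hS : 6 * ∑ i, y i ^ 2 + 4 * ∑ i, y i * d i + ∑ i, d i ^ 2
      = ∑ i, (6 * y i ^ 2 + 4 * (y i * d i) + d i ^ 2) := by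
    simp only [Finset.sum_add_distrib, Finset.mul_sum]
  rw [hS, Finset.sum_mul]
  refine Finset.sum_le_sum fun i _ => mul_le_mul_of_nonneg_left ?_ (sq_nonneg _)
  exact Finset.single_le_sum (f := fun i => 6 * y i ^ 2 + 4 * (y i * d i) + d i ^ 2)
    (fun j _ => by nlinarith [sq_nonneg (2 * y j + d j), sq_nonneg (y j)]) (Finset.mem_univ i)

/-- For `α, β ≥ 0`, `σ > 0`, the subproblem objective `φ` is `1`-smooth
relative to the kernel `h(x) = ((α+3β)/4)‖x‖⁴ + (σ/2)‖x‖²`: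
`φ(x) ≤ φ(y) + ⟨∇φ(y), x − y⟩ + D_h(x, y)` for all `x, y ∈ ℝ^r`. -/
theorem subproblem_relative_smoothness {r : ℕ} (α β σ : ℝ) (hα : 0 ≤ α) (hβ : 0 ≤ β)
    (hσ : 0 < σ) (η : EuclideanSpace ℝ (Fin r)) :
    ∀ x y : EuclideanSpace ℝ (Fin r),
      subphi α β σ η x ≤ subphi α β σ η y + ⟪gradient (subphi α β σ η) y, x - y⟫ +
        (subker α β σ x - subker α β σ y - ⟪gradient (subker α β σ) y, x - y⟫) := by
  intro x y
  obtain ⟨d, rfl⟩ : ∃ d, x = y + d := ⟨x - y, by abel⟩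
  rw [aux_phi_inner, aux_ker_inner, add_sub_cancel_left]
  have h4 : ∀ z : EuclideanSpace ℝ (Fin r), ‖z‖ ^ 4 = (‖z‖ ^ 2) ^ 2 := fun z => by ring
  have hq : ∑ i, (y + d) i ^ 4 = ∑ i, y i ^ 4 + 4 * ∑ i, y i ^ 3 * d i
      + ∑ i, d i ^ 2 * (6 * y i ^ 2 + 4 * (y i * d i) + d i ^ 2) := by
    simp only [Finset.mul_sum, ← Finset.sum_add_distrib]
    refine Finset.sum_congr rfl fun i _ => ?_
    rw [PiLp.add_apply]
    ring
  have hl : ∑ i, η i * (y + d) i = ∑ i, η i * y i + ∑ i, η i * d i := by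
    simp only [← Finset.sum_add_distrib]
    refine Finset.sum_congr rfl fun i _ => ?_
    rw [PiLp.add_apply]
    ring
  have key := aux_ineq (fun i => y i) (fun i => d i)
  have hi : ∑ i, y i * d i = ⟪y, d⟫ := by
    simp [PiLp.inner_apply, mul_comm]
  rw [← EuclideanSpace.real_norm_sq_eq, ← EuclideanSpace.real_norm_sq_eq, hi] at key
  unfold subphi subker
  simp only [h4]
  rw [hq, hl, norm_add_sq_real]
  generalize ∑ i, d i ^ 2 * (6 * y i ^ 2 + 4 * (y i * d i) + d i ^ 2) = Q at *
  generalize ‖y‖ ^ 2 = s at *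
  generalize ‖d‖ ^ 2 = u at *
  generalize ⟪y, d⟫ = t at *
  have h5 : 0 ≤ 12 * t ^ 2 + 12 * t * u + 3 * u ^ 2 + 6 * s * u - Q := by
    nlinarith [sq_nonneg (2 * t + u), sq_nonneg t, sq_nonneg (3 * t + u)]
  have h6 := mul_nonneg hβ h5
  linarith
end

section
/- Let E be a real inner product space (e.g., ℝ^{n×r} with the Frobenius inner product), let f : E → ℝ be differentiable, g : E → ℝ convex, h : E → ℝ differentiable and convex, and λ > 0. Let X ∈ E and suppose X⁺ is a global minimizer over E of the function U ↦ g(U) + ⟨∇f(X), U − X⟩ + (1/λ)·D_h(U, X), and suppose the sufficient decrease condition f(X⁺) ≤ f(X) + ⟨∇f(X), X⁺ − X⟩ + (1/λ)·D_h(X⁺, X) holds. Then f(X⁺) + g(X⁺) ≤ f(X) + g(X) − (1/λ)·D_h(X, X⁺). -/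
open RealInnerProductSpace

/-- key decrease inequality for the Dyn-NoLips iteration.
On a real inner product space `E`, let `f` be differentiable with gradient `G = ∇f(X)` at
`X`, `g` convex, `h` differentiable (with gradient `h'`) and convex, and `λ > 0`.  If `X⁺`
is a global minimizer of `U ↦ g(U) + ⟨∇f(X), U − X⟩ + (1/λ)D_h(U, X)` and the sufficient
decrease condition holds, then `Ψ(X⁺) ≤ Ψ(X) − (1/λ)D_h(X, X⁺)` where `Ψ = f + g`. -/
theorem dyn_nolips_decrease
    {E : Type*} [NormedAddCommGroup E] [InnerProductSpace ℝ E]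
    (f g h : E → ℝ) (h' : E → E) (G : E) (lam : ℝ) (hlam : 0 < lam) (X Xp : E)
    (hfgrad : HasFDerivAt f (innerSL ℝ G) X)
    (hgconv : ConvexOn ℝ Set.univ g)
    (hhgrad : ∀ x, HasFDerivAt h (innerSL ℝ (h' x)) x)
    (hhconv : ConvexOn ℝ Set.univ h)
    (hmin : ∀ U, g Xp + ⟪G, Xp - X⟫ + (1 / lam) * (h Xp - h X - ⟪h' X, Xp - X⟫) ≤
      g U + ⟪G, U - X⟫ + (1 / lam) * (h U - h X - ⟪h' X, U - X⟫))
    (hdec : f Xp ≤ f X + ⟪G, Xp - X⟫ + (1 / lam) * (h Xp - h X - ⟪h' X, Xp - X⟫)) :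
    f Xp + g Xp ≤ f X + g X - (1 / lam) * (h X - h Xp - ⟪h' Xp, X - Xp⟫) := by
  have key : ⟪h' X, X - Xp⟫ - lam * (g X - g Xp + ⟪G, X - Xp⟫) ≤ ⟪h' Xp, X - Xp⟫ := by
    have hd := ((hhgrad Xp).hasLineDerivAt (X - Xp)).tendsto_slope_zero_right
    rw [innerSL_apply_apply] at hd
    refine ge_of_tendsto hd ?_
    filter_upwards [Ioo_mem_nhdsGT (zero_lt_one' ℝ)] with t ht
    obtain ⟨t0, t1⟩ := ht
    have hg := hgconv.2 (Set.mem_univ Xp) (Set.mem_univ X) (sub_nonneg.2 t1.le) t0.le (by ring)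
    have e : (1 - t) • Xp + t • X = Xp + t • (X - Xp) := by module
    rw [e] at hg
    have hm := hmin (Xp + t • (X - Xp))
    have e2 : Xp + t • (X - Xp) - X = (Xp - X) + t • (X - Xp) := by abel
    rw [e2, inner_add_right, inner_add_right, inner_smul_right, inner_smul_right] at hm
    simp only [smul_eq_mul] at hg ⊢
    rw [inv_mul_eq_div, le_div_iff₀ t0]
    have h3 : 0 ≤ t * (g X - g Xp + ⟪G, X - Xp⟫) +
        (1 / lam) * (h (Xp + t • (X - Xp)) - h Xp - t * ⟪h' X, X - Xp⟫) := by
      linarith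
    have h4 := mul_nonneg hlam.le h3
    rw [mul_add, ← mul_assoc lam (1 / lam), mul_one_div_cancel hlam.ne'] at h4
    linarith
  have k2 := mul_le_mul_of_nonneg_left key (one_div_pos.2 hlam).le
  rw [mul_sub, ← mul_assoc (1 / lam) lam, one_div_mul_cancel hlam.ne'] at k2
  rw [← neg_sub X Xp, inner_neg_right, inner_neg_right] at hdec
  linarith
end
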